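/- Let λ ≥ 1 and let R_λ² be the Banaś–Frączek space. Then L_YJ(1, 1, R_λ²) = 2 − 1/λ². (Since the constant L_YJ(ξ, η, X) with ξ = η = 1 coincides with the von Neumann–Jordan constant C_NJ(X), this recovers C_NJ(R_λ²) = 2 − 1/λ².) -/

import Mathlib

/-- The norm of the Banaś–Frączek space `R_λ²`:  `‖(a,b)‖ = max {λ|a|, √(a²+b²)}`. -/
noncomputable def BFnorm (lam : ℝ) (p : ℝ × ℝ) : ℝ :=
  max (lam * |p.1|) (Real.sqrt (p.1 ^ 2 + p.2 ^ 2))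

/-- The constant `L_YJ(ξ, η, R_λ²)`. -/
noncomputable def LYJ (ξ η lam : ℝ) : ℝ :=
  sSup { r : ℝ | ∃ x y : ℝ × ℝ, (x, y) ≠ (0, 0) ∧
    r = (BFnorm lam (ξ • x + η • y) ^ 2 + BFnorm lam (η • x - ξ • y) ^ 2) /
        ((ξ ^ 2 + η ^ 2) * (BFnorm lam x ^ 2 + BFnorm lam y ^ 2)) }

/-- The von Neumann–Jordan constant `C_NJ(R_λ²)`. -/
noncomputable def CNJ (lam : ℝ) : ℝ :=
  sSup { r : ℝ | ∃ x y : ℝ × ℝ, (x, y) ≠ (0, 0) ∧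
    r = (BFnorm lam (x + y) ^ 2 + BFnorm lam (x - y) ^ 2) /
        (2 * BFnorm lam x ^ 2 + 2 * BFnorm lam y ^ 2) }

lemma BFnorm_sq {lam : ℝ} (hlam : 1 ≤ lam) (p : ℝ × ℝ) :
    BFnorm lam p ^ 2 = max (lam ^ 2 * p.1 ^ 2) (p.1 ^ 2 + p.2 ^ 2) := by
  have h1 : 0 ≤ lam * |p.1| := by positivity
  have h2 : (lam * |p.1|) ^ 2 = lam ^ 2 * p.1 ^ 2 := by rw [mul_pow, sq_abs]
  have h3 : Real.sqrt (p.1 ^ 2 + p.2 ^ 2) ^ 2 = p.1 ^ 2 + p.2 ^ 2 := Real.sq_sqrt (by positivity)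
  have h4 := Real.sqrt_nonneg (p.1 ^ 2 + p.2 ^ 2)
  rw [BFnorm, ← h2, ← h3]
  rcases le_total (lam * |p.1|) (Real.sqrt (p.1 ^ 2 + p.2 ^ 2)) with h | h
  · rw [Real.sqrt_sq h4, max_eq_right h, max_eq_right (pow_le_pow_left₀ h1 h 2)]
  · rw [Real.sqrt_sq h4, max_eq_left h, max_eq_left (pow_le_pow_left₀ h4 h 2)]

/-- The squared norm is dominated by the quadratic form `λ² a² + b²`. -/
lemma BFnorm_sq_le {lam : ℝ} (hlam : 1 ≤ lam) (p : ℝ × ℝ) :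
    BFnorm lam p ^ 2 ≤ lam ^ 2 * p.1 ^ 2 + p.2 ^ 2 := by
  rw [BFnorm_sq hlam]
  have hL : 1 ≤ lam ^ 2 := one_le_pow₀ hlam
  exact max_le (by nlinarith [sq_nonneg p.2]) (by nlinarith [sq_nonneg p.1])

/-- The quadratic form `λ² a² + b²` is dominated by `2 - 1/λ²` times the squared norm. -/
lemma le_mul_BFnorm_sq {lam : ℝ} (hlam : 1 ≤ lam) (p : ℝ × ℝ) :
    lam ^ 2 * p.1 ^ 2 + p.2 ^ 2 ≤ (2 - 1 / lam ^ 2) * BFnorm lam p ^ 2 := by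
  rw [BFnorm_sq hlam]
  have hL : 1 ≤ lam ^ 2 := one_le_pow₀ hlam
  have h1 := le_max_left (lam ^ 2 * p.1 ^ 2) (p.1 ^ 2 + p.2 ^ 2)
  have h2 := le_max_right (lam ^ 2 * p.1 ^ 2) (p.1 ^ 2 + p.2 ^ 2)
  have h3 : 0 ≤ 1 - 1 / lam ^ 2 := by
    rw [sub_nonneg, div_le_one (by positivity)]
    exact hL
  have h4 := mul_le_mul_of_nonneg_left h1 h3
  have h5 : (1 - 1 / lam ^ 2) * (lam ^ 2 * p.1 ^ 2) = lam ^ 2 * p.1 ^ 2 - p.1 ^ 2 := by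
    field_simp
  linarith

lemma BFnorm_sq_add_le {lam : ℝ} (hlam : 1 ≤ lam) (x y : ℝ × ℝ) :
    BFnorm lam (x + y) ^ 2 + BFnorm lam (x - y) ^ 2 ≤
      (2 - 1 / lam ^ 2) * (2 * BFnorm lam x ^ 2 + 2 * BFnorm lam y ^ 2) := by
  have h1 := BFnorm_sq_le hlam (x + y)
  have h2 := BFnorm_sq_le hlam (x - y)
  have h3 := le_mul_BFnorm_sq hlam x
  have h4 := le_mul_BFnorm_sq hlam y
  simp only [Prod.fst_add, Prod.snd_add, Prod.fst_sub, Prod.snd_sub] at h1 h2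
  linarith

lemma LYJ_one_one (lam : ℝ) : LYJ 1 1 lam = CNJ lam := by
  unfold LYJ CNJ
  congr 1
  ext r
  simp only [one_smul, one_pow, one_add_one_eq_two, mul_add]

lemma CNJ_eq {lam : ℝ} (hlam : 1 ≤ lam) : CNJ lam = 2 - 1 / lam ^ 2 := by
  have hL : 1 ≤ lam ^ 2 := one_le_pow₀ hlam
  have hinv : 1 / lam ^ 2 ≤ 1 := by
    rw [div_le_one (by positivity)]
    exact hL
  refine IsGreatest.csSup_eq ⟨?_, ?_⟩
  · set s := Real.sqrt (1 - 1 / lam ^ 2)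
    have hs : s ^ 2 = 1 - 1 / lam ^ 2 := Real.sq_sqrt (by linarith)
    have hlam0 : lam ≠ 0 := by positivity
    have hmul : lam ^ 2 * (1 / lam ^ 2) = 1 := by field_simp
    refine ⟨(1 / lam, s), (1 / lam, -s), ?_, ?_⟩
    · simp [hlam0]
    · have hx : BFnorm lam (1 / lam, s) ^ 2 = 1 := by
        simp [BFnorm_sq hlam, hs, hlam0]
      have hy : BFnorm lam (1 / lam, -s) ^ 2 = 1 := by
        simp [BFnorm_sq hlam, hs, hlam0]
      have hadd : BFnorm lam ((1 / lam, s) + (1 / lam, -s)) ^ 2 = 4 := by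
        have h1 : lam ^ 2 * (1 / lam + 1 / lam) ^ 2 = 4 := by field_simp; norm_num
        have h2 : (1 / lam + 1 / lam) ^ 2 + (s + -s) ^ 2 = 4 * (1 / lam ^ 2) := by ring
        rw [BFnorm_sq hlam, Prod.mk_add_mk, h1, h2, max_eq_left (by linarith)]
      have hsub : BFnorm lam ((1 / lam, s) - (1 / lam, -s)) ^ 2 = 4 * (1 - 1 / lam ^ 2) := by
        have h1 : lam ^ 2 * (1 / lam - 1 / lam) ^ 2 = 0 := by ring
        have h2 : (1 / lam - 1 / lam) ^ 2 + (s - -s) ^ 2 = 4 * (1 - 1 / lam ^ 2) := by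
          rw [← hs]; ring
        rw [BFnorm_sq hlam, Prod.mk_sub_mk, h1, h2, max_eq_right (by linarith)]
      rw [hx, hy, hadd, hsub]
      ring
  · rintro r ⟨x, y, -, rfl⟩
    exact div_le_of_le_mul₀ (by positivity) (by linarith) (BFnorm_sq_add_le hlam x y)

theorem stmt7 (lam : ℝ) (hlam : 1 ≤ lam) :
    LYJ 1 1 lam = 2 - 1 / lam ^ 2 ∧ CNJ lam = 2 - 1 / lam ^ 2 := by
  exact ⟨(LYJ_one_one lam).trans (CNJ_eq hlam), CNJ_eq hlam⟩
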